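/- Let P be an ω-poset. If P is weakly tangled then the spectrum SP is hereditarily indecomposable, meaning that any two closed connected subsets of SP that intersect are comparable under inclusion. Conversely, if P is in addition regular and prime, and SP is hereditarily indecomposable, then P is weakly tangled. -/

import Mathlib

/-- `A` refines `B`: every element of `A` lies below some element of `B`. -/
def Refines {α : Type*} [PartialOrder α] (A B : Set α) : Prop :=
  ∀ a ∈ A, ∃ b ∈ B, a ≤ b

/-- A band: a finite subset such that every element of the poset is comparable with some member. -/
def IsBand {α : Type*} [PartialOrder α] (B : Set α) : Prop :=
  B.Finite ∧ ∀ p : α, ∃ b ∈ B, p ≤ b ∨ b ≤ p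

/-- A cap: a subset refined by some band. -/
def IsCap {α : Type*} [PartialOrder α] (C : Set α) : Prop :=
  ∃ B : Set α, IsBand B ∧ Refines B C

/-- A minimal cap: a cap no proper subset of which is a cap. -/
def IsMinimalCap {α : Type*} [PartialOrder α] (C : Set α) : Prop :=
  IsCap C ∧ ∀ D : Set α, D ⊂ C → ¬ IsCap D

/-- A selector: a subset meeting every cap. -/
def IsSelector {α : Type*} [PartialOrder α] (S : Set α) : Prop :=
  ∀ C : Set α, IsCap C → (S ∩ C).Nonempty

/-- A minimal selector: a selector minimal under inclusion among selectors. -/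
def IsMinSelector {α : Type*} [PartialOrder α] (S : Set α) : Prop :=
  IsSelector S ∧ ∀ T : Set α, T ⊆ S → IsSelector T → T = S

/-- An ω-poset: every principal filter is finite, and for each `n` only finitely many
principal filters have exactly `n` elements. -/
def IsOmegaPoset (α : Type*) [PartialOrder α] : Prop :=
  (∀ p : α, (Set.Ici p).Finite) ∧ ∀ n : ℕ, {p : α | (Set.Ici p).ncard = n}.Finite

/-- The rank of `p`: the length of the longest strictly increasing chain starting at `p`,
i.e. `r(p) = sup_{q > p} (r(q) + 1)`. -/
noncomputable def chainRank {α : Type*} [PartialOrder α] (p : α) : ℕ :=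
  sSup {n : ℕ | ∃ c : ℕ → α, c 0 = p ∧ ∀ i < n, c i < c (i + 1)}

/-- The `n`-th level: the minimal elements of the `n`-th cone `{p | chainRank p ≤ n}`. -/
def levelSet (α : Type*) [PartialOrder α] (n : ℕ) : Set α :=
  {p : α | chainRank p ≤ n ∧ ∀ q : α, q < p → ¬ chainRank q ≤ n}

/-- Predetermined: every non-minimal `p` has some `q < p` all of whose strict upper bounds
lie above `p`. -/
def Predetermined (α : Type*) [PartialOrder α] : Prop :=
  ∀ p : α, ¬ IsMin p → ∃ q : α, q < p ∧ ∀ r : α, q < r → p ≤ r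

/-- Branching. -/
def Branching (α : Type*) [PartialOrder α] : Prop :=
  ∀ p q : α, p < q → ∃ r : α, r < q ∧ ¬ r ≤ p ∧ ¬ p ≤ r

/-- The cap-order on elements: `p ≾ q` iff adding `q` to any family keeping `p` a cap keeps a cap. -/
def CapBelow {α : Type*} [PartialOrder α] (p q : α) : Prop :=
  ∀ F : Set α, IsCap (F ∪ {p}) → IsCap (F ∪ {q})

/-- Cap-determined: the cap-order on elements agrees with the order. -/
def CapDetermined (α : Type*) [PartialOrder α] : Prop :=
  ∀ p q : α, CapBelow p q → p ≤ q

/-- Graded: immediate predecessors have rank exactly one more. -/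
def GradedPoset (α : Type*) [PartialOrder α] : Prop :=
  ∀ p q : α, p ⋖ q → chainRank p = chainRank q + 1

/-- `Wedge p q`: `p` and `q` have a common lower bound. -/
def Wedge {α : Type*} [PartialOrder α] (p q : α) : Prop :=
  ∃ r : α, r ≤ p ∧ r ≤ q

/-- Star-below: `p ◁ q` iff there is a cap `C` with every element of the star `Cp` below `q`. -/
def StarBelow {α : Type*} [PartialOrder α] (p q : α) : Prop :=
  ∃ C : Set α, IsCap C ∧ ∀ c ∈ C, Wedge c p → c ≤ q

/-- Regular: every cap is ◁-refined by some cap. -/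
def RegularPoset (α : Type*) [PartialOrder α] : Prop :=
  ∀ C : Set α, IsCap C → ∃ D : Set α, IsCap D ∧ ∀ d ∈ D, ∃ c ∈ C, StarBelow d c

/-- Prime: for every `p` there is `F` with `F ∪ {p}` a cap but `F` not a cap. -/
def PrimePoset (α : Type*) [PartialOrder α] : Prop :=
  ∀ p : α, ∃ F : Set α, IsCap (F ∪ {p}) ∧ ¬ IsCap F

/-- Cluster: connected with respect to the common-lower-bound relation. -/
def IsCluster {α : Type*} [PartialOrder α] (C : Set α) : Prop :=
  ∀ A B : Set α, A.Nonempty → B.Nonempty → A ∪ B = C → ∃ a ∈ A, ∃ b ∈ B, Wedge a b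

/-- `D^{≤_B ≥}`: the elements sharing an upper bound in `B` with some element of `D`. -/
def SharedUpper {α : Type*} [PartialOrder α] (D B : Set α) : Set α :=
  {p : α | ∃ d ∈ D, ∃ b ∈ B, p ≤ b ∧ d ≤ b}

/-- Weakly tangled refinement. -/
def WeaklyTangledRefinement {α : Type*} [PartialOrder α] (A B : Set α) : Prop :=
  Refines A B ∧ ∀ C D : Set α, C ⊆ A → D ⊆ A → IsCluster C → IsCluster D →
    (C ∩ D).Nonempty → C ⊆ SharedUpper D B ∨ D ⊆ SharedUpper C B

/-- Weakly tangled poset: every cap has a weakly tangled refinement which is a cap. -/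
def WeaklyTangled (α : Type*) [PartialOrder α] : Prop :=
  ∀ C : Set α, IsCap C → ∃ A : Set α, IsCap A ∧ WeaklyTangledRefinement A C

/-- Injectivity of `≤` from level `n` to level `m`: every `p` in level `m` has a witness
`q` in level `n` below `p` and below no other element of level `m`. -/
def LevelInjOn (α : Type*) [PartialOrder α] (m n : ℕ) : Prop :=
  ∀ p ∈ levelSet α m, ∃ q ∈ levelSet α n,
    q ≤ p ∧ ∀ p' ∈ levelSet α m, q ≤ p' → p' = p

/-- The spectrum: the set of minimal selectors. -/
def Spectrum (α : Type*) [PartialOrder α] : Type _ :=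
  {S : Set α // IsMinSelector S}

/-- The topology on the spectrum generated by the sets `p^∈ = {S | p ∈ S}`. -/
instance {α : Type*} [PartialOrder α] : TopologicalSpace (Spectrum α) :=
  TopologicalSpace.generateFrom
    {U : Set (Spectrum α) | ∃ p : α, U = {S : Spectrum α | p ∈ S.1}}

/-- A basis of nonempty (open) sets. -/
def IsNeBasis {X : Type*} [TopologicalSpace X] (P : Set (Set X)) : Prop :=
  TopologicalSpace.IsTopologicalBasis P ∧ ∀ p ∈ P, p.Nonempty

/-- Cap-basis: a basis of nonempty open sets whose caps (under inclusion) are exactly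
the covers of the space. -/
def IsCapBasis {X : Type*} [TopologicalSpace X] (P : Set (Set X)) : Prop :=
  IsNeBasis P ∧ ∀ C : Set ↥P, (IsCap C ↔ (⋃ c ∈ C, (c : Set X)) = Set.univ)

/-- Band-basis: a basis of nonempty open sets whose bands (under inclusion) are exactly
the finite covers of the space. -/
def IsBandBasis {X : Type*} [TopologicalSpace X] (P : Set (Set X)) : Prop :=
  IsNeBasis P ∧ ∀ B : Set ↥P, (IsBand B ↔ B.Finite ∧ (⋃ b ∈ B, (b : Set X)) = Set.univ)

section Caps

variable {α : Type*} [PartialOrder α]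

lemma Refines.trans {A B C : Set α} (hAB : Refines A B) (hBC : Refines B C) : Refines A C := by
  intro a ha
  obtain ⟨b, hb, hab⟩ := hAB a ha
  obtain ⟨c, hc, hbc⟩ := hBC b hb
  exact ⟨c, hc, hab.trans hbc⟩

lemma IsCap.of_refines {C D : Set α} (hC : IsCap C) (hCD : Refines C D) : IsCap D := by
  obtain ⟨B, hB, hBC⟩ := hC
  exact ⟨B, hB, hBC.trans hCD⟩

lemma IsCap.mono {C D : Set α} (hC : IsCap C) (hCD : C ⊆ D) : IsCap D :=
  hC.of_refines fun c hc => ⟨c, hCD hc, le_rfl⟩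

lemma IsCap.exists_finite_subset {C : Set α} (hC : IsCap C) :
    ∃ D ⊆ C, D.Finite ∧ IsCap D := by
  obtain ⟨B, hB, hBC⟩ := hC
  choose! f hf using hBC
  refine ⟨f '' B, ?_, hB.1.image f, B, hB, fun b hb => ⟨f b, ⟨b, hb, rfl⟩, (hf b hb).2⟩⟩
  rintro _ ⟨b, hb, rfl⟩
  exact (hf b hb).1

/-- Every selector contains a minimal selector. -/
lemma IsSelector.exists_isMinSelector {S : Set α} (hS : IsSelector S) :
    ∃ T ⊆ S, IsMinSelector T := by
  obtain ⟨T, hTS, hT⟩ := zorn_superset_nonempty {T : Set α | IsSelector T} (by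
    intro c hc hchain hne
    refine ⟨⋂₀ c, ?_, fun s hs => Set.sInter_subset_of_mem hs⟩
    intro C hC
    obtain ⟨D, hDC, hDfin, hD⟩ := hC.exists_finite_subset
    by_contra hempty
    have hex : ∀ d ∈ D, ∃ s ∈ c, d ∉ s := by
      intro d hd
      by_contra! hall
      exact hempty ⟨d, fun s hs => hall s hs, hDC hd⟩
    choose! f hf using hex
    obtain ⟨s₀, hs₀⟩ := hne
    obtain ⟨d₀, -, hd₀⟩ := hc hs₀ D hD
    obtain ⟨m, hm, hmin⟩ := Set.Finite.exists_minimalFor f D hDfin ⟨d₀, hd₀⟩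
    obtain ⟨x, hx, hxD⟩ := hc (hf m hm).1 D hD
    rcases hchain.total (hf m hm).1 (hf x hxD).1 with hle | hle
    · exact (hf x hxD).2 (hle hx)
    · exact (hf x hxD).2 (hmin hxD hle hx)) S hS
  exact ⟨T, hTS, hT.prop, fun R hRT hR => subset_antisymm hRT (hT.le_of_le hR hRT)⟩

/-- The complement of a non-cap contains a minimal selector. -/
lemma exists_isMinSelector_disjoint {C : Set α} (hC : ¬ IsCap C) :
    ∃ S : Set α, IsMinSelector S ∧ Disjoint S C := by
  have hsel : IsSelector Cᶜ := by
    intro D hD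
    by_contra hempty
    refine hC (hD.mono fun d hd => ?_)
    by_contra hdC
    exact hempty ⟨d, hdC, hd⟩
  obtain ⟨T, hT, hmin⟩ := hsel.exists_isMinSelector
  exact ⟨T, hmin, Set.subset_compl_iff_disjoint_right.mp hT⟩

namespace IsMinSelector

variable {S T : Set α}

lemma exists_cap_inter_eq_singleton (hS : IsMinSelector S) {s : α} (hs : s ∈ S) :
    ∃ C : Set α, IsCap C ∧ S ∩ C = {s} := by
  have hnot : ¬ IsSelector (S \ {s}) := by
    intro hsel
    have heq := hS.2 _ Set.sdiff_subset hsel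
    rw [← heq] at hs
    exact hs.2 rfl
  simp only [IsSelector, not_forall] at hnot
  obtain ⟨C, hC, hempty⟩ := hnot
  have hall : ∀ x ∈ S ∩ C, x = s := by
    intro x hx
    by_contra hxs
    exact hempty ⟨x, ⟨hx.1, hxs⟩, hx.2⟩
  obtain ⟨x, hx⟩ := hS.1 C hC
  exact ⟨C, hC, subset_antisymm hall (Set.singleton_subset_iff.mpr (hall x hx ▸ hx))⟩

lemma mem_of_le (hS : IsMinSelector S) {s q : α} (hs : s ∈ S) (hsq : s ≤ q) : q ∈ S := by
  obtain ⟨C, hC, hSC⟩ := hS.exists_cap_inter_eq_singleton hs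
  have hcap : IsCap (insert q (C \ {s})) := by
    refine hC.of_refines fun c hc => ?_
    by_cases hcs : c = s
    · exact ⟨q, Set.mem_insert _ _, hcs ▸ hsq⟩
    · exact ⟨c, Set.mem_insert_of_mem _ ⟨hc, hcs⟩, le_rfl⟩
  obtain ⟨x, hxS, hx | hx⟩ := hS.1 _ hcap
  · exact hx ▸ hxS
  · exact absurd (hSC.subset ⟨hxS, hx.1⟩) hx.2

lemma eq_of_subset (hS : IsMinSelector S) (hT : IsMinSelector T) (hST : S ⊆ T) : S = T :=
  hT.2 S hST hS.1

end IsMinSelector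

/-- The elements above which every strict chain has fewer than `n` further steps. -/
def heightCone (α : Type*) [PartialOrder α] : ℕ → Set α
  | 0 => ∅
  | n + 1 => {p | Set.Ioi p ⊆ heightCone α n}

lemma heightCone_mono : Monotone (heightCone α) := by
  refine monotone_nat_of_le_succ fun n => ?_
  induction n with
  | zero => exact Set.empty_subset _
  | succ n ih => exact fun p hp => Set.Subset.trans hp ih

lemma mem_heightCone_of_le {n : ℕ} {p q : α} (hp : p ∈ heightCone α n) (hpq : p ≤ q) :
    q ∈ heightCone α n := by
  cases n with
  | zero => exact hp
  | succ n => exact fun r (hr : q < r) => hp (hpq.trans_lt hr)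

namespace IsOmegaPoset

lemma wellFoundedGT (h : IsOmegaPoset α) : WellFoundedGT α := by
  refine ⟨Subrelation.wf (r := InvImage (· < ·) fun p : α => (Set.Ici p).ncard) ?_
    (InvImage.wf _ wellFounded_lt)⟩
  intro q p hqp
  exact Set.ncard_lt_ncard (Set.Ici_ssubset_Ici.mpr hqp) (h.1 p)

lemma finite_heightCone (h : IsOmegaPoset α) (n : ℕ) : (heightCone α n).Finite := by
  induction n with
  | zero => exact Set.finite_empty
  | succ n ih =>
    refine ((Set.finite_Iic ((heightCone α n).ncard + 1)).biUnion fun k _ => h.2 k).subset ?_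
    intro p hp
    refine Set.mem_biUnion (x := (Set.Ici p).ncard) ?_ rfl
    rw [Set.mem_Iic, ← Set.Ioi_insert]
    exact (Set.ncard_insert_le _ _).trans (Nat.add_le_add_right (Set.ncard_le_ncard hp ih) 1)

lemma exists_mem_heightCone (h : IsOmegaPoset α) (p : α) : ∃ n, p ∈ heightCone α n := by
  have := h.wellFoundedGT
  induction p using WellFoundedGT.induction with
  | ind p ih =>
    choose! f hf using ih
    obtain ⟨N, hN⟩ := (((h.1 p).subset Set.Ioi_subset_Ici_self).image f).bddAbove
    exact ⟨N + 1, fun q hq => heightCone_mono (hN ⟨q, hq, rfl⟩) (hf q hq)⟩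

lemma exists_minimal_ge (h : IsOmegaPoset α) (n : ℕ) {p : α} (hp : p ∉ heightCone α (n + 1)) :
    ∃ q, Minimal (· ∈ heightCone α (n + 1)) q ∧ p ≤ q := by
  obtain ⟨q, hpq, hq⟩ := ((h.1 p).subset
    (Set.inter_subset_left : Set.Ici p ∩ (heightCone α (n + 1))ᶜ ⊆ _)).exists_le_maximal
      ⟨le_rfl, hp⟩
  have hqabove : ∀ r, q < r → r ∈ heightCone α (n + 1) := by
    intro r hr
    by_contra hrn
    exact hr.not_ge (hq.le_of_ge ⟨hpq.trans hr.le, hrn⟩ hr.le)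
  obtain ⟨r, hqr, hrn⟩ := Set.not_subset.mp hq.prop.2
  refine ⟨r, ⟨hqabove r hqr, fun s hs hsr => ?_⟩, hpq.trans (le_of_lt hqr)⟩
  by_contra hrs
  exact hrn (hs (lt_of_le_not_ge hsr hrs))

lemma isBand_minimal_heightCone (h : IsOmegaPoset α) (n : ℕ) :
    IsBand {p | Minimal (· ∈ heightCone α (n + 1)) p} := by
  refine ⟨(h.finite_heightCone (n + 1)).subset fun p hp => hp.prop, fun p => ?_⟩
  by_cases hp : p ∈ heightCone α (n + 1)
  · obtain ⟨q, hqp, hq⟩ := (h.finite_heightCone (n + 1)).exists_le_minimal hp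
    exact ⟨q, hq, Or.inr hqp⟩
  · obtain ⟨q, hq, hpq⟩ := h.exists_minimal_ge n hp
    exact ⟨q, hq, Or.inl hpq⟩

/-- An ω-poset has a sequence of caps that eventually refines every cap. -/
lemma exists_cofinal_caps (h : IsOmegaPoset α) :
    ∃ L : ℕ → Set α, (∀ n, IsCap (L n)) ∧
      ∀ C : Set α, IsCap C → ∃ N, ∀ n ≥ N, Refines (L n) C := by
  refine ⟨fun n => {p | Minimal (· ∈ heightCone α (n + 1)) p}, fun n =>
    ⟨_, h.isBand_minimal_heightCone n, fun p hp => ⟨p, hp, le_rfl⟩⟩, ?_⟩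
  rintro C ⟨B, hB, hBC⟩
  choose f hf using h.exists_mem_heightCone
  obtain ⟨N, hN⟩ := (hB.1.image f).bddAbove
  refine ⟨N, fun n hn => Refines.trans (fun p hp => ?_) hBC⟩
  obtain ⟨b, hb, hpb | hbp⟩ := hB.2 p
  · exact ⟨b, hb, hpb⟩
  · refine ⟨b, hb, hp.le_of_le (heightCone_mono ?_ (hf b)) hbp⟩
    exact (hN ⟨b, hb, rfl⟩).trans (hn.trans n.le_succ)

lemma exists_cap_refines_both (h : IsOmegaPoset α) {C D : Set α} (hC : IsCap C) (hD : IsCap D) :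
    ∃ E : Set α, IsCap E ∧ Refines E C ∧ Refines E D := by
  obtain ⟨L, hL, hcof⟩ := h.exists_cofinal_caps
  obtain ⟨M, hM⟩ := hcof C hC
  obtain ⟨N, hN⟩ := hcof D hD
  exact ⟨L (max M N), hL _, hM _ (le_max_left _ _), hN _ (le_max_right _ _)⟩

/-- Minimal selectors of an ω-poset are down-directed. -/
lemma exists_le_of_mem (h : IsOmegaPoset α) {S : Set α} (hS : IsMinSelector S) {p q : α}
    (hp : p ∈ S) (hq : q ∈ S) : ∃ r ∈ S, r ≤ p ∧ r ≤ q := by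
  obtain ⟨C, hC, hSC⟩ := hS.exists_cap_inter_eq_singleton hp
  obtain ⟨D, hD, hSD⟩ := hS.exists_cap_inter_eq_singleton hq
  obtain ⟨E, hE, hEC, hED⟩ := h.exists_cap_refines_both hC hD
  obtain ⟨r, hrS, hrE⟩ := hS.1 E hE
  obtain ⟨c, hc, hrc⟩ := hEC r hrE
  obtain ⟨d, hd, hrd⟩ := hED r hrE
  have hcp : c = p := hSC.subset ⟨hS.mem_of_le hrS hrc, hc⟩
  have hdq : d = q := hSD.subset ⟨hS.mem_of_le hrS hrd, hd⟩
  exact ⟨r, hrS, hcp ▸ hrc, hdq ▸ hrd⟩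

lemma wedge_of_mem (h : IsOmegaPoset α) {S : Set α} (hS : IsMinSelector S) {p q : α}
    (hp : p ∈ S) (hq : q ∈ S) : Wedge p q := by
  obtain ⟨r, -, hr⟩ := h.exists_le_of_mem hS hp hq
  exact ⟨r, hr⟩

end IsOmegaPoset

end Caps

namespace Spectrum

variable {α : Type*} [PartialOrder α]

/-- The basic open set `p^∈` of minimal selectors containing `p`. -/
def basicOpen (p : α) : Set (Spectrum α) := {S | p ∈ S.1}

lemma isOpen_basicOpen (p : α) : IsOpen (basicOpen p) :=
  TopologicalSpace.isOpen_generateFrom_of_mem ⟨p, rfl⟩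

lemma basicOpen_mono {p q : α} (hpq : p ≤ q) : basicOpen p ⊆ basicOpen q :=
  fun S hS => S.2.mem_of_le hS hpq

/-- Caps are exactly the families whose basic open sets cover the spectrum. -/
lemma isCap_iff_forall_exists_mem {C : Set α} :
    IsCap C ↔ ∀ S : Spectrum α, ∃ c ∈ C, S ∈ basicOpen c := by
  constructor
  · intro hC S
    obtain ⟨c, hcS, hc⟩ := S.2.1 C hC
    exact ⟨c, hc, hcS⟩
  · intro hcov
    by_contra hC
    obtain ⟨S, hS, hdisj⟩ := exists_isMinSelector_disjoint hC
    obtain ⟨c, hc, hcS⟩ := hcov ⟨S, hS⟩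
    exact hdisj.le_bot ⟨hcS, hc⟩

lemma exists_mem_notMem {S T : Spectrum α} (hST : S ≠ T) : ∃ p, S ∈ basicOpen p ∧ T ∉ basicOpen p :=
  Set.not_subset.mp fun hsub => hST (Subtype.ext (S.2.eq_of_subset T.2 hsub))

instance : CompactSpace (Spectrum α) := by
  refine compactSpace_generateFrom rfl ?_
  intro 𝒰 h𝒰 hcov
  have hcap : IsCap {p : α | basicOpen p ∈ 𝒰} := by
    rw [isCap_iff_forall_exists_mem]
    intro S
    obtain ⟨U, hU, hSU⟩ := Set.mem_sUnion.mp (hcov ▸ Set.mem_univ S)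
    obtain ⟨p, rfl⟩ := h𝒰 hU
    exact ⟨p, hU, hSU⟩
  obtain ⟨D, hD, hDfin, hDcap⟩ := hcap.exists_finite_subset
  refine ⟨basicOpen '' D, Set.image_subset_iff.mpr hD, hDfin.image _, ?_⟩
  refine Set.eq_univ_of_forall fun S => ?_
  obtain ⟨c, hc, hS⟩ := isCap_iff_forall_exists_mem.mp hDcap S
  exact ⟨_, ⟨c, hc, rfl⟩, hS⟩

lemma exists_basicOpen_subset (h : IsOmegaPoset α) {U : Set (Spectrum α)} (hU : IsOpen U)
    {S : Spectrum α} (hS : S ∈ U) : ∃ p, S ∈ basicOpen p ∧ basicOpen p ⊆ U := by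
  induction hU with
  | basic V hV =>
    obtain ⟨p, rfl⟩ := hV
    exact ⟨p, hS, subset_rfl⟩
  | univ =>
    obtain ⟨L, hL, -⟩ := h.exists_cofinal_caps
    obtain ⟨p, hp, -⟩ := S.2.1 _ (hL 0)
    exact ⟨p, hp, Set.subset_univ _⟩
  | inter V W _ _ hV hW =>
    obtain ⟨p, hp, hpV⟩ := hV hS.1
    obtain ⟨q, hq, hqW⟩ := hW hS.2
    obtain ⟨r, hr, hrp, hrq⟩ := h.exists_le_of_mem S.2 hp hq
    exact ⟨r, hr, Set.subset_inter ((basicOpen_mono hrp).trans hpV)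
      ((basicOpen_mono hrq).trans hqW)⟩
  | sUnion 𝒱 _ ih =>
    obtain ⟨V, hV, hSV⟩ := hS
    obtain ⟨p, hp, hpV⟩ := ih V hV hSV
    exact ⟨p, hp, hpV.trans (Set.subset_sUnion_of_mem hV)⟩

/-- The spectrum of a regular ω-poset is Hausdorff. -/
lemma t2Space (h : IsOmegaPoset α) (hreg : RegularPoset α) : T2Space (Spectrum α) := by
  refine ⟨fun S T hST => ?_⟩
  obtain ⟨s, hsS, hsT⟩ := exists_mem_notMem hST
  obtain ⟨C, hC, hSC⟩ := S.2.exists_cap_inter_eq_singleton hsS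
  obtain ⟨D, hD, hDC⟩ := hreg C hC
  obtain ⟨d, hdS, hdD⟩ := S.2.1 D hD
  obtain ⟨c, hc, E, hE, hstar⟩ := hDC d hdD
  obtain ⟨e, heS, heE⟩ := S.2.1 E hE
  have hec := hstar e heE (h.wedge_of_mem S.2 heS hdS)
  have hcs : c = s := hSC.subset ⟨S.2.mem_of_le heS hec, hc⟩
  obtain ⟨f, hfT, hfE⟩ := T.2.1 E hE
  refine ⟨basicOpen d, basicOpen f, isOpen_basicOpen d, isOpen_basicOpen f, hdS, hfT, ?_⟩
  rw [Set.disjoint_left]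
  intro R hRd hRf
  have hfc := hstar f hfE (h.wedge_of_mem R.2 hRf hRd)
  exact hsT (T.2.mem_of_le hfT (hcs ▸ hfc))

lemma nonempty_basicOpen (hprime : PrimePoset α) (p : α) : (basicOpen p).Nonempty := by
  obtain ⟨F, hF, hF'⟩ := hprime p
  obtain ⟨S, hS, hdisj⟩ := exists_isMinSelector_disjoint hF'
  obtain ⟨x, hxS, hx | rfl⟩ := hS.1 _ hF
  · exact (hdisj.le_bot ⟨hxS, hx⟩).elim
  · exact ⟨⟨S, hS⟩, hxS⟩

/-- The members of `A` whose basic open sets meet a connected set form a cluster. -/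
lemma isCluster_meeting (h : IsOmegaPoset α) {A : Set α} (hA : IsCap A)
    {Y : Set (Spectrum α)} (hY : IsPreconnected Y) :
    IsCluster {a ∈ A | (Y ∩ basicOpen a).Nonempty} := by
  intro E F hE hF hEF
  have hmeet : ∀ G : Set α, G.Nonempty → G ⊆ E ∪ F →
      (Y ∩ ⋃ g ∈ G, basicOpen g).Nonempty := by
    rintro G ⟨g, hg⟩ hG
    obtain ⟨S, hSY, hSg⟩ := (hEF ▸ hG hg).2
    exact ⟨S, hSY, Set.mem_biUnion hg hSg⟩
  have hcov : Y ⊆ (⋃ g ∈ E, basicOpen g) ∪ ⋃ g ∈ F, basicOpen g := by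
    intro S hS
    obtain ⟨a, haS, ha⟩ := S.2.1 A hA
    have haEF : a ∈ E ∪ F := hEF ▸ ⟨ha, S, hS, haS⟩
    exact haEF.imp (fun haE => Set.mem_biUnion haE haS) (fun haF => Set.mem_biUnion haF haS)
  obtain ⟨S, -, hSE, hSF⟩ := hY _ _ (isOpen_biUnion fun g _ => isOpen_basicOpen g)
    (isOpen_biUnion fun g _ => isOpen_basicOpen g) hcov
    (hmeet E hE Set.subset_union_left) (hmeet F hF Set.subset_union_right)
  obtain ⟨e, he, hSe⟩ := Set.mem_iUnion₂.mp hSE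
  obtain ⟨f, hf, hSf⟩ := Set.mem_iUnion₂.mp hSF
  exact ⟨e, he, f, hf, h.wedge_of_mem S.2 hSe hSf⟩

/-- A point outside a closed set is separated from it by a cap, all of whose members
containing the point miss the closed set. -/
lemma isCap_separating (h : IsOmegaPoset α) {Z : Set (Spectrum α)} (hZ : IsClosed Z)
    {S : Spectrum α} (hS : S ∉ Z) :
    IsCap {p : α | S ∈ basicOpen p → Disjoint Z (basicOpen p)} := by
  rw [isCap_iff_forall_exists_mem]
  intro T
  rcases eq_or_ne T S with rfl | hTS
  · obtain ⟨p, hp, hpZ⟩ := exists_basicOpen_subset h hZ.isOpen_compl hS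
    exact ⟨p, fun _ => Set.disjoint_left.mpr fun R hRZ hRp => hpZ hRp hRZ, hp⟩
  · obtain ⟨p, hpT, hpS⟩ := exists_mem_notMem hTS
    exact ⟨p, fun hp => absurd hp hpS, hpT⟩

lemma subset_of_meeting_subset_sharedUpper {A C : Set α} (hA : IsCap A)
    {Y Z : Set (Spectrum α)} {S : Spectrum α} (hSY : S ∈ Y)
    (hC : Refines C {p : α | S ∈ basicOpen p → Disjoint Z (basicOpen p)}) :
    ¬ {a ∈ A | (Y ∩ basicOpen a).Nonempty} ⊆
      SharedUpper {a ∈ A | (Z ∩ basicOpen a).Nonempty} C := by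
  intro hsub
  obtain ⟨a, haS, ha⟩ := S.2.1 A hA
  obtain ⟨b, ⟨-, T, hTZ, hTb⟩, c, hc, hac, hbc⟩ := hsub ⟨ha, S, hSY, haS⟩
  obtain ⟨p, hp, hcp⟩ := hC c hc
  exact (hp (basicOpen_mono (hac.trans hcp) haS)).le_bot
    ⟨hTZ, basicOpen_mono (hbc.trans hcp) hTb⟩

lemma subset_or_subset_of_weaklyTangled (h : IsOmegaPoset α) (hwt : WeaklyTangled α)
    {Y Z : Set (Spectrum α)} (hYc : IsClosed Y) (hZc : IsClosed Z) (hY : IsPreconnected Y)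
    (hZ : IsPreconnected Z) (hYZ : (Y ∩ Z).Nonempty) : Y ⊆ Z ∨ Z ⊆ Y := by
  by_contra! hcon
  obtain ⟨S, hSY, hSZ⟩ := Set.not_subset.mp hcon.1
  obtain ⟨T, hTZ, hTY⟩ := Set.not_subset.mp hcon.2
  obtain ⟨C, hC, hCS, hCT⟩ := h.exists_cap_refines_both (isCap_separating h hZc hSZ)
    (isCap_separating h hYc hTY)
  obtain ⟨A, hA, -, htan⟩ := hwt C hC
  obtain ⟨R, hRY, hRZ⟩ := hYZ
  obtain ⟨a, haR, ha⟩ := R.2.1 A hA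
  rcases htan _ _ (Set.sep_subset _ _) (Set.sep_subset _ _) (isCluster_meeting h hA hY)
    (isCluster_meeting h hA hZ) ⟨a, ⟨ha, R, hRY, haR⟩, ha, R, hRZ, haR⟩ with hsub | hsub
  · exact subset_of_meeting_subset_sharedUpper hA hSY hCS hsub
  · exact subset_of_meeting_subset_sharedUpper hA hTZ hCT hsub

open Filter

/-- The limit along `u` of a sequence of subsets of the poset. -/
def limitSet (u : Ultrafilter ℕ) (D : ℕ → Set α) : Set (Spectrum α) :=
  {S | ∀ p, S ∈ basicOpen p → ∀ᶠ n in u, ∃ d ∈ D n, d ≤ p}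

lemma isClosed_limitSet (u : Ultrafilter ℕ) (D : ℕ → Set α) : IsClosed (limitSet u D) := by
  rw [← isOpen_compl_iff, isOpen_iff_forall_mem_open]
  intro S hS
  simp only [limitSet, Set.mem_compl_iff, Set.mem_ofPred_eq, not_forall] at hS
  obtain ⟨p, hp, hev⟩ := hS
  exact ⟨basicOpen p, fun T hT hTD => hev (hTD p hT), isOpen_basicOpen p, hp⟩

/-- A sequence that eventually refines every cap clusters at some minimal selector. -/
lemma exists_limit (u : Ultrafilter ℕ) {d : ℕ → α}
    (hd : ∀ C : Set α, IsCap C → ∀ᶠ n in u, ∃ c ∈ C, d n ≤ c) :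
    ∃ S : Spectrum α, ∀ p, S ∈ basicOpen p → ∀ᶠ n in u, d n ≤ p := by
  have hsel : IsSelector {p : α | ∀ᶠ n in u, d n ≤ p} := by
    intro C hC
    obtain ⟨D, hDC, hDfin, hD⟩ := hC.exists_finite_subset
    have hev : (⋃ c ∈ D, {n | d n ≤ c}) ∈ u := by
      filter_upwards [hd D hD] with n hn
      simpa using hn
    obtain ⟨c, hc, hcu⟩ := (Ultrafilter.finite_biUnion_mem_iff hDfin).mp hev
    exact ⟨c, hcu, hDC hc⟩
  obtain ⟨T, hT, hmin⟩ := hsel.exists_isMinSelector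
  exact ⟨⟨T, hmin⟩, fun p hp => hT hp⟩

/-- Limits of clusters along an ultrafilter are connected. -/
lemma isPreconnected_limitSet (h : IsOmegaPoset α) (hreg : RegularPoset α)
    (hprime : PrimePoset α) (u : Ultrafilter ℕ) {D : ℕ → Set α}
    (hD : ∀ C : Set α, IsCap C → ∀ᶠ n in u, Refines (D n) C) (hclus : ∀ n, IsCluster (D n)) :
    IsPreconnected (limitSet u D) := by
  have := t2Space h hreg
  rw [isPreconnected_iff_subset_of_fully_disjoint_closed (isClosed_limitSet u D)]
  intro Y Z hY hZ hcov hYZ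
  obtain ⟨U, V, hU, hV, hYU, hZV, hUV⟩ := normal_separation hY hZ hYZ
  have hsmall : ∀ᶠ n in u, ∀ d ∈ D n, basicOpen d ⊆ U ∨ basicOpen d ⊆ V := by
    by_contra hcon
    rw [← Ultrafilter.eventually_not] at hcon
    push Not at hcon
    have : Nonempty α := let ⟨_, d, _⟩ := hcon.exists; ⟨d⟩
    obtain ⟨d, hd⟩ := skolem.mp hcon
    obtain ⟨S, hS⟩ := exists_limit u (d := d) fun C hC => by
      filter_upwards [hd, hD C hC] with n hn href
      exact href _ hn.1
    have hSD : S ∈ limitSet u D := fun p hp => by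
      filter_upwards [hd, hS p hp] with n hn hle
      exact ⟨d n, hn.1, hle⟩
    have hlarge : ∀ W : Set (Spectrum α), IsOpen W → S ∈ W → ∀ᶠ n in u, basicOpen (d n) ⊆ W := by
      intro W hW hSW
      obtain ⟨p, hp, hpW⟩ := exists_basicOpen_subset h hW hSW
      filter_upwards [hS p hp] with n hn
      exact (basicOpen_mono hn).trans hpW
    rcases hcov hSD with hSY | hSZ
    · obtain ⟨n, hn, hnU⟩ := (hd.and (hlarge U hU (hYU hSY))).exists
      exact hn.2.1 hnU
    · obtain ⟨n, hn, hnV⟩ := (hd.and (hlarge V hV (hZV hSZ))).exists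
      exact hn.2.2 hnV
  have hside : ∀ᶠ n in u, (∀ d ∈ D n, basicOpen d ⊆ U) ∨ ∀ d ∈ D n, basicOpen d ⊆ V := by
    filter_upwards [hsmall] with n hn
    by_contra! hcon
    obtain ⟨⟨a, ha, haU⟩, b, hb, hbV⟩ := hcon
    obtain ⟨x, hx, y, hy, r, hrx, hry⟩ := hclus n {d ∈ D n | basicOpen d ⊆ U}
      {d ∈ D n | basicOpen d ⊆ V} ⟨b, hb, (hn b hb).resolve_right hbV⟩
      ⟨a, ha, (hn a ha).resolve_left haU⟩
      (by ext d; exact ⟨fun hd => hd.elim And.left And.left, fun hd => (hn d hd).imp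
        (fun hdU => ⟨hd, hdU⟩) fun hdV => ⟨hd, hdV⟩⟩)
    obtain ⟨S, hS⟩ := nonempty_basicOpen hprime r
    exact hUV.le_bot ⟨hx.2 (basicOpen_mono hrx hS), hy.2 (basicOpen_mono hry hS)⟩
  have havoid : ∀ {U V Z : Set (Spectrum α)}, IsOpen V → Disjoint U V → Z ⊆ V →
      (∀ᶠ n in u, ∀ d ∈ D n, basicOpen d ⊆ U) → ∀ S ∈ limitSet u D, S ∉ Z := by
    intro U V Z hV hUV hZV hev S hS hSZ
    obtain ⟨p, hp, hpV⟩ := exists_basicOpen_subset h hV (hZV hSZ)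
    obtain ⟨n, hn, d, hd, hdp⟩ := (hev.and (hS p hp)).exists
    obtain ⟨T, hT⟩ := nonempty_basicOpen hprime d
    exact hUV.le_bot ⟨hn d hd hT, hpV (basicOpen_mono hdp hT)⟩
  rcases Ultrafilter.eventually_or.mp hside with hev | hev
  · exact Or.inl fun S hS => (hcov hS).resolve_right (havoid hV hUV hZV hev S hS)
  · exact Or.inr fun S hS => (hcov hS).resolve_left (havoid hU hUV.symm hYU hev S hS)

lemma not_limitSet_subset (u : Ultrafilter ℕ) {C : Set α} (hC : IsCap C) {D E : ℕ → Set α}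
    (hD : ∀ C : Set α, IsCap C → ∀ᶠ n in u, Refines (D n) C)
    (hDE : ∀ n, ¬ D n ⊆ SharedUpper (E n) C) : ¬ limitSet u D ⊆ limitSet u E := by
  intro hsub
  choose d hdD hdE using fun n => Set.not_subset.mp (hDE n)
  obtain ⟨S, hS⟩ := exists_limit u (d := d) fun K hK =>
    (hD K hK).mono fun n hn => hn _ (hdD n)
  obtain ⟨c, hcS, hc⟩ := S.2.1 C hC
  have hSE := hsub (fun p hp => (hS p hp).mono fun n hn => ⟨d n, hdD n, hn⟩ :
    S ∈ limitSet u D)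
  obtain ⟨n, hdc, e, he, hec⟩ := ((hS c hcS).and (hSE c hcS)).exists
  exact hdE n ⟨e, he, c, hc, hdc, hec⟩

lemma weaklyTangled_of_subset_or_subset (h : IsOmegaPoset α) (hreg : RegularPoset α)
    (hprime : PrimePoset α)
    (hind : ∀ Y Z : Set (Spectrum α), IsClosed Y → IsClosed Z →
      IsPreconnected Y → IsPreconnected Z → (Y ∩ Z).Nonempty → Y ⊆ Z ∨ Z ⊆ Y) :
    WeaklyTangled α := by
  intro C hC
  by_contra! hcon
  obtain ⟨L, hL, hcof⟩ := h.exists_cofinal_caps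
  obtain ⟨N, hN⟩ := hcof C hC
  have hex : ∀ n, ∃ D E : Set α, D ⊆ L (n + N) ∧ E ⊆ L (n + N) ∧ IsCluster D ∧ IsCluster E ∧
      (D ∩ E).Nonempty ∧ ¬ D ⊆ SharedUpper E C ∧ ¬ E ⊆ SharedUpper D C := by
    intro n
    by_contra! hall
    refine hcon _ (hL (n + N)) ⟨hN _ (Nat.le_add_left _ _), fun D E hD hE hDc hEc hDE => ?_⟩
    exact or_iff_not_imp_left.mpr (hall D E hD hE hDc hEc hDE)
  choose D E hDL hEL hDc hEc hDE hDnot hEnot using hex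
  let u : Ultrafilter ℕ := hyperfilter ℕ
  have hfine : ∀ A : ℕ → Set α, (∀ n, A n ⊆ L (n + N)) →
      ∀ K : Set α, IsCap K → ∀ᶠ n in u, Refines (A n) K := by
    intro A hA K hK
    obtain ⟨M, hM⟩ := hcof K hK
    have hev : ∀ᶠ n in u, M ≤ n := Nat.hyperfilter_le_atTop (eventually_ge_atTop M)
    filter_upwards [hev] with n hn a ha
    exact hM _ (hn.trans (Nat.le_add_right _ _)) a (hA n ha)
  choose w hwD hwE using hDE
  obtain ⟨S, hS⟩ := exists_limit u (d := w) fun K hK =>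
    (hfine D hDL K hK).mono fun n hn => hn _ (hwD n)
  have hmeet : (limitSet u D ∩ limitSet u E).Nonempty :=
    ⟨S, fun p hp => (hS p hp).mono fun n hn => ⟨w n, hwD n, hn⟩,
      fun p hp => (hS p hp).mono fun n hn => ⟨w n, hwE n, hn⟩⟩
  rcases hind _ _ (isClosed_limitSet u D) (isClosed_limitSet u E)
    (isPreconnected_limitSet h hreg hprime u (hfine D hDL) hDc)
    (isPreconnected_limitSet h hreg hprime u (hfine E hEL) hEc) hmeet with hsub | hsub
  · exact not_limitSet_subset u hC (hfine D hDL) hDnot hsub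
  · exact not_limitSet_subset u hC (hfine E hEL) hEnot hsub

end Spectrum

/-- For an ω-poset, weak tangledness implies the spectrum is hereditarily
indecomposable; conversely for regular prime ω-posets. -/
theorem weaklyTangled_iff_hereditarilyIndecomposable {α : Type*} [PartialOrder α]
    (h : IsOmegaPoset α) :
    (WeaklyTangled α →
      ∀ Y Z : Set (Spectrum α), IsClosed Y → IsClosed Z →
        IsPreconnected Y → IsPreconnected Z → (Y ∩ Z).Nonempty → Y ⊆ Z ∨ Z ⊆ Y) ∧
    (RegularPoset α → PrimePoset α →
      (∀ Y Z : Set (Spectrum α), IsClosed Y → IsClosed Z →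
        IsPreconnected Y → IsPreconnected Z → (Y ∩ Z).Nonempty → Y ⊆ Z ∨ Z ⊆ Y) →
      WeaklyTangled α) := by
  exact ⟨fun hwt _ _ hYc hZc hY hZ hYZ =>
    Spectrum.subset_or_subset_of_weaklyTangled h hwt hYc hZc hY hZ hYZ,
    fun hreg hprime hind => Spectrum.weaklyTangled_of_subset_or_subset h hreg hprime hind⟩
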